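/- Let X be a gamma random variable with density (θ^α/Γ(α)) x^{α−1} e^{−θx} on (0, ∞), where α, θ > 0. Let m, n be nonnegative integers with n ≥ 1, ℓ = max{m, n}, and let g : (0, ∞) → ℝ be (ℓ−1)-times continuously differentiable with g^{(ℓ−1)} absolutely continuous on (0, ∞) (a.e. derivative g^{(ℓ)}), E[X^n (g^{(n)}(X))²] < ∞, and E[X^i |g^{(i)}(X)|] < ∞ for i = n+1, …, m. Define S_{m,n}(g) = Σ_{i=1}^{m} (C(m,i)/((m+n)_i [α]_i))(E[X^i g^{(i)}(X)])² + Σ_{i=1}^{n} (−1)^{i−1}(C(n,i)/((m+n)_i θ^i)) E[X^i (g^{(i)}(X))²]. Then (−1)^n (Var[g(X)] − S_{m,n}(g)) ≥ 0, with equality if and only if g is a polynomial of degree at most m+n on (0, ∞). -/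

import Mathlib

open MeasureTheory ProbabilityTheory Finset Filter

noncomputable section

/-- Falling factorial `(x)_k = x (x-1) ⋯ (x-k+1)`, with `(x)_0 = 1`. -/
def fall (x : ℝ) (k : ℕ) : ℝ := ∏ j ∈ Finset.range k, (x - j)

/-- Rising factorial `[x]_k = x (x+1) ⋯ (x+k-1)`, with `[x]_0 = 1`. -/
def rise (x : ℝ) (k : ℕ) : ℝ := ∏ j ∈ Finset.range k, (x + j)

/-- The product `∏_{j=a}^{a+len-1} (1 - j δ)` of `len` consecutive factors
(an empty product is `1`). -/
def pp (δ a : ℝ) (len : ℕ) : ℝ := ∏ j ∈ Finset.range len, (1 - (a + j) * δ)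

/-- The open real interval with (possibly infinite) endpoints `α ω : EReal`. -/
def erealIoo (α ω : EReal) : Set ℝ := {x : ℝ | α < (x : EReal) ∧ (x : EReal) < ω}

/-- `g` coincides on `J` with a polynomial of degree at most `d`. -/
def IsPolyOn (g : ℝ → ℝ) (J : Set ℝ) (d : ℕ) : Prop :=
  ∃ p : Polynomial ℝ, p.natDegree ≤ d ∧ ∀ x ∈ J, g x = p.eval x

/-- The quadratic `q(x) = δ x² + β x + γ` of a Pearson family. -/
def pq (δ β γ : ℝ) : ℝ → ℝ := fun x => δ * x ^ 2 + β * x + γ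

/-- `P` is the distribution of a random variable with density `f` (w.r.t. Lebesgue
measure) belonging to the integrated Pearson family `IP(μ; δ, β, γ)`:
`μ` is the (finite) mean of `P`, `|δ|+|β|+|γ| > 0`, and
`∫_{-∞}^x (μ - t) f(t) dt = q(x) f(x)` for all `x`. -/
def IsIntegratedPearson (P : Measure ℝ) (f : ℝ → ℝ) (μ δ β γ : ℝ) : Prop :=
  IsProbabilityMeasure P ∧
  (∀ x, 0 ≤ f x) ∧
  P = volume.withDensity (fun x => ENNReal.ofReal (f x)) ∧
  Integrable (fun x : ℝ => x) P ∧
  μ = ∫ x, x ∂P ∧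
  0 < |δ| + |β| + |γ| ∧
  ∀ x : ℝ, (∫ t in Set.Iic x, (μ - t) * f t) = pq δ β γ x * f x

/-- Membership in the class `H^{m,n}(X)` for the distribution `P` of `X` with Pearson
quadratic `q` and support `J`.  Here `gd k` plays the role of the `k`-th derivative
`g^{(k)}` of `g = gd 0` on `J`.  With `ℓ = max m n`:  `g ∈ C^{ℓ-1}(J)`
(encoded by `gd k` having derivative `gd (k+1)` at every point of `J` for `k+1 < ℓ`,
and `gd (ℓ-1)` continuous on `J`), `g^{(ℓ-1)}` is absolutely continuous on `J` with
a.e. derivative `g^{(ℓ)} = gd ℓ` (encoded by the fundamental theorem of calculus: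
`gd ℓ` is locally integrable and `gd (ℓ-1)` is its integral on every subinterval of `J`),
and the moment conditions `E[q(X)^n (g^{(n)}(X))²] < ∞` and
`E[q(X)^i |g^{(i)}(X)|] < ∞` for `n < i ≤ m` hold. -/
def MemH (P : Measure ℝ) (q : ℝ → ℝ) (J : Set ℝ) (m n : ℕ) (gd : ℕ → ℝ → ℝ) : Prop :=
  (∀ k, k + 1 < max m n → ∀ x ∈ J, HasDerivAt (gd k) (gd (k + 1) x) x) ∧
  (1 ≤ max m n → ContinuousOn (gd (max m n - 1)) J) ∧
  (1 ≤ max m n → ∀ a ∈ J, ∀ b ∈ J,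
    IntervalIntegrable (gd (max m n)) volume a b ∧
      gd (max m n - 1) b - gd (max m n - 1) a = ∫ t in a..b, gd (max m n) t) ∧
  Integrable (fun x => q x ^ n * (gd n x) ^ 2) P ∧
  ∀ i, n < i → i ≤ m → Integrable (fun x => q x ^ i * |gd i x|) P

/-- The variance bound `S_{m,n}(g)` of Theorem 2.1, for a Pearson distribution `P`
with quadratic `q` and parameter `δ`. -/
def Sbound (P : Measure ℝ) (δ : ℝ) (q : ℝ → ℝ) (m n : ℕ) (gd : ℕ → ℝ → ℝ) : ℝ :=
  (∑ i ∈ Finset.Icc 1 m,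
      ((m.choose i : ℝ) * pp δ ((m : ℝ) + i) n /
          (fall ((m : ℝ) + n) i * (∫ x, q x ^ i ∂P) * pp δ ((i : ℝ) - 1) i *
            pp δ (m : ℝ) n)) *
        (∫ x, q x ^ i * gd i x ∂P) ^ 2) +
    ∑ i ∈ Finset.Icc 1 n,
      (-1 : ℝ) ^ (i - 1) *
          ((n.choose i : ℝ) / (fall ((m : ℝ) + n) i * pp δ (m : ℝ) i)) *
        ∫ x, q x ^ i * (gd i x) ^ 2 ∂P

/-- The density of the gamma distribution with shape `a > 0` and rate `t > 0`. -/
def gammaDensity (a t : ℝ) : ℝ → ℝ := fun x =>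
  if 0 < x then t ^ a / Real.Gamma a * x ^ (a - 1) * Real.exp (-t * x) else 0

/-- The bound `S_{m,n}(g)` specialized to the gamma distribution:
`S_{m,n}(g) = Σ_{i=1}^{m} (C(m,i)/((m+n)_i [α]_i))(E X^i g^{(i)}(X))²
  + Σ_{i=1}^{n} (−1)^{i−1}(C(n,i)/((m+n)_i θ^i)) E X^i (g^{(i)}(X))²`. -/
def SgammaBound (P : Measure ℝ) (a t : ℝ) (m n : ℕ) (gd : ℕ → ℝ → ℝ) : ℝ :=
  (∑ i ∈ Finset.Icc 1 m,
      (m.choose i : ℝ) / (fall ((m : ℝ) + n) i * rise a i) *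
        (∫ x, x ^ i * gd i x ∂P) ^ 2) +
    ∑ i ∈ Finset.Icc 1 n,
      (-1 : ℝ) ^ (i - 1) * ((n.choose i : ℝ) / (fall ((m : ℝ) + n) i * t ^ i)) *
        ∫ x, x ^ i * (gd i x) ^ 2 ∂P

lemma gvb_wd_aux {μ : Measure ℝ} (f : ℝ → ℝ) (hf : AEMeasurable f μ) (b : ℝ)
    (h_integ : ∀ c ∈ Set.Ioo (-b) b, Integrable (fun x => f x * Real.exp (c * x)) μ) :
    Set.Ioo (-b) b ⊆ interior (integrableExpSet id
      (μ.withDensity (fun x => ENNReal.ofReal (f x)))) := by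
  apply interior_maximal _ isOpen_Ioo
  intro c hc
  simp only [integrableExpSet, Set.mem_ofPred_eq]
  rw [integrable_withDensity_iff_integrable_smul₀' hf.ennreal_ofReal
    (by simp)]
  refine (h_integ c hc).mono ?_ ?_
  · apply AEMeasurable.aestronglyMeasurable
    exact (hf.ennreal_ofReal.ennreal_toReal).mul (by fun_prop)
  · filter_upwards with x
    simp only [smul_eq_mul, norm_mul, id, Real.norm_eq_abs]
    refine mul_le_mul_of_nonneg_right ?_ (abs_nonneg _)
    rw [abs_of_nonneg ENNReal.toReal_nonneg, ENNReal.toReal_ofReal']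
    exact max_le (le_abs_self _) (abs_nonneg _)

/-- A signed density with exponential moments and vanishing moments is zero. -/
lemma gvb_moment_unique {μ : Measure ℝ} [SigmaFinite μ] (f : ℝ → ℝ) (hf : AEMeasurable f μ)
    (b : ℝ) (hb : 0 < b)
    (h_integ : ∀ c ∈ Set.Ioo (-b) b, Integrable (fun x => f x * Real.exp (c * x)) μ)
    (hmi : ∀ k : ℕ, Integrable (fun x => f x * x ^ k) μ)
    (hm : ∀ k : ℕ, ∫ x, f x * x ^ k ∂μ = 0) : f =ᵐ[μ] 0 := by
  have hfn : AEMeasurable (fun x => -f x) μ := hf.neg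
  set ν₁ := μ.withDensity (fun x => ENNReal.ofReal (f x)) with hν₁
  set ν₂ := μ.withDensity (fun x => ENNReal.ofReal (-f x)) with hν₂
  have h1 := gvb_wd_aux f hf b h_integ
  have h2 := gvb_wd_aux (fun x => -f x) hf.neg b
    (fun c hc => by simpa using (h_integ c hc).neg)
  rw [← hν₁] at h1
  rw [← hν₂] at h2
  have hfi : Integrable f μ := by simpa using hmi 0
  have : IsFiniteMeasure ν₁ := isFiniteMeasure_withDensity_ofReal hfi.2
  have : IsFiniteMeasure ν₂ := isFiniteMeasure_withDensity_ofReal hfi.neg.2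
  have hmom : ∀ k : ℕ, ∫ x, x ^ k ∂ν₁ = ∫ x, x ^ k ∂ν₂ := by
    intro k
    rw [hν₁, hν₂, integral_withDensity_eq_integral_toReal_smul₀ hf.ennreal_ofReal (by simp),
      integral_withDensity_eq_integral_toReal_smul₀ hfn.ennreal_ofReal (by simp)]
    rw [← sub_eq_zero, ← integral_sub, ← hm k]
    · apply integral_congr_ae
      filter_upwards with x
      simp only [smul_eq_mul, ENNReal.toReal_ofReal', ← sub_mul]
      congr 1
      rcases le_total (f x) 0 with h | h
      · simp [h]
      · simp [h]
    · refine (hmi k).mono ?_ ?_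
      · apply AEMeasurable.aestronglyMeasurable
        exact (hf.ennreal_ofReal.ennreal_toReal).mul (by fun_prop)
      · filter_upwards with x
        simp only [smul_eq_mul, norm_mul, Real.norm_eq_abs]
        refine mul_le_mul_of_nonneg_right ?_ (abs_nonneg _)
        rw [abs_of_nonneg ENNReal.toReal_nonneg, ENNReal.toReal_ofReal']
        exact max_le (le_abs_self _) (abs_nonneg _)
    · refine (hmi k).mono ?_ ?_
      · apply AEMeasurable.aestronglyMeasurable
        exact (hfn.ennreal_ofReal.ennreal_toReal).mul (by fun_prop)
      · filter_upwards with x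
        simp only [smul_eq_mul, norm_mul, Real.norm_eq_abs]
        refine mul_le_mul_of_nonneg_right ?_ (abs_nonneg _)
        rw [abs_of_nonneg ENNReal.toReal_nonneg, ENNReal.toReal_ofReal']
        exact max_le (neg_le_abs _) (abs_nonneg _)
  set U : Set ℂ := Complex.re ⁻¹' (Set.Ioo (-b) b) with hU
  have a1 : AnalyticOnNhd ℂ (complexMGF id ν₁) U := fun z hz =>
    analyticAt_complexMGF (h1 hz)
  have a2 : AnalyticOnNhd ℂ (complexMGF id ν₂) U := fun z hz =>
    analyticAt_complexMGF (h2 hz)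
  have hUc : IsPreconnected U := by
    apply Convex.isPreconnected
    exact (convex_Ioo (-b) b).linear_preimage Complex.reLm
  have h0 : (0 : ℂ) ∈ U := by simp [hU, hb]
  have hd : ∀ k, iteratedDeriv k (complexMGF id ν₁) 0 = iteratedDeriv k (complexMGF id ν₂) 0 := by
    intro k
    rw [iteratedDeriv_complexMGF (h1 h0), iteratedDeriv_complexMGF (h2 h0)]
    simp only [id, zero_mul, Complex.exp_zero, mul_one]
    have := congrArg (fun r : ℝ => (r : ℂ)) (hmom k)
    simp only [← integral_complex_ofReal] at this
    simpa using this
  have hev : complexMGF id ν₁ =ᶠ[nhds 0] complexMGF id ν₂ := by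
    have e1 := (a1 0 h0).hasFPowerSeriesAt
    have e2 := (a2 0 h0).hasFPowerSeriesAt
    simp only [hd] at e1
    filter_upwards [e1.eventually_hasSum_sub, e2.eventually_hasSum_sub] with z hz1 hz2
    exact hz1.unique hz2
  have heq := a1.eqOn_of_preconnected_of_eventuallyEq a2 hUc h0 hev
  have hν : ν₁ = ν₂ := by
    apply Measure.ext_of_charFun
    ext r
    rw [← complexMGF_id_mul_I, ← complexMGF_id_mul_I]
    apply heq
    simp [hU, hb]
  have := (withDensity_eq_iff hf.ennreal_ofReal hfn.ennreal_ofReal hfi.lintegral_lt_top.ne).1 hν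
  filter_upwards [this] with x hx
  have h4 : max (f x) 0 = max (- f x) 0 := by
    have := congrArg ENNReal.toReal hx
    simpa [ENNReal.toReal_ofReal'] using this
  rcases le_total (f x) 0 with h | h
  · simp [h] at h4; simpa using h4
  · simp [h] at h4; simpa using h4

/-- Gamma weight. -/
def gw (t s x : ℝ) : ℝ := x ^ (s - 1) * Real.exp (-t * x)

lemma gw_pos (t s : ℝ) {x : ℝ} (hx : 0 < x) : 0 < gw t s x := by
  unfold gw; positivity

lemma gw_add_nat (t s : ℝ) (j : ℕ) {x : ℝ} (hx : 0 < x) : gw t (s + j) x = x ^ j * gw t s x := by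
  unfold gw
  rw [show s + j - 1 = (s - 1) + j by ring, Real.rpow_add hx, Real.rpow_natCast]; ring

lemma gw_succ (t s : ℝ) {x : ℝ} (hx : 0 < x) : gw t (s + 1) x = x * gw t s x := by
  have := gw_add_nat t s 1 hx
  simpa using this

lemma gw_measurable (t s : ℝ) : Measurable (gw t s) := by
  unfold gw; fun_prop

lemma gw_continuousOn (t s : ℝ) : ContinuousOn (gw t s) (Set.Ioi 0) := by
  unfold gw
  apply ContinuousOn.mul
  · exact ContinuousOn.rpow_const continuousOn_id (fun x hx => Or.inl (ne_of_gt hx))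
  · fun_prop

lemma gw_integrableOn {t s : ℝ} (ht : 0 < t) (hs : 0 < s) : IntegrableOn (gw t s) (Set.Ioi 0) := by
  have := integrableOn_rpow_mul_exp_neg_mul_rpow (p := 1) (s := s - 1) (b := t)
    (by linarith) one_pos ht
  have e : gw t s = fun x => x ^ (s - 1) * Real.exp (-t * x ^ (1 : ℝ)) := by
    ext x; simp [gw]
  rw [e]; exact this

lemma gw_integral {t s : ℝ} (ht : 0 < t) (hs : 0 < s) :
    ∫ x in Set.Ioi 0, gw t s x = Real.Gamma s / t ^ s := by
  have := Real.integral_rpow_mul_exp_neg_mul_Ioi hs ht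
  unfold gw
  simp only [neg_mul]
  rw [this, one_div, Real.inv_rpow ht.le]; ring

lemma gw_hasDerivAt (t s : ℝ) {x : ℝ} (hx : 0 < x) :
    HasDerivAt (gw t (s + 1)) ((s - t * x) * gw t s x) x := by
  unfold gw
  have h1 : HasDerivAt (fun x : ℝ => x ^ (s + 1 - 1)) _ x :=
    Real.hasDerivAt_rpow_const (Or.inl hx.ne')
  have h2 : HasDerivAt (fun x : ℝ => Real.exp (-t * x)) (Real.exp (-t * x) * (-t * 1)) x :=
    ((hasDerivAt_id x).const_mul (-t)).exp
  refine (h1.mul h2).congr_deriv ?_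
  have : x ^ (s + 1 - 1) = x * x ^ (s - 1) := by
    rw [show s + 1 - 1 = 1 + (s - 1) by ring, Real.rpow_add hx, Real.rpow_one]
  rw [this, show s + 1 - 1 - 1 = s - 1 by ring]
  ring

lemma gw_tendsto {t : ℝ} (ht : 0 < t) (s : ℝ) : Tendsto (gw t s) atTop (nhds 0) :=
  tendsto_rpow_mul_exp_neg_mul_atTop_nhds_zero _ _ ht

/-- The derivative of `gw t (s+1)`. -/
def gu (t s x : ℝ) : ℝ := (s - t * x) * gw t s x

lemma gu_measurable (t s : ℝ) : Measurable (gu t s) := by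
  unfold gu; exact (by fun_prop : Measurable fun x => s - t * x).mul (gw_measurable t s)

lemma gu_eq (t s : ℝ) {x : ℝ} (hx : 0 < x) : gu t s x = s * gw t s x - t * gw t (s + 1) x := by
  rw [gw_succ t s hx, gu]; ring

lemma gu_integrableOn {t s : ℝ} (ht : 0 < t) (hs : 0 < s) : IntegrableOn (gu t s) (Set.Ioi 0) := by
  have := ((gw_integrableOn ht hs).const_mul s).sub
    ((gw_integrableOn ht (by linarith : 0 < s + 1)).const_mul t)
  refine IntegrableOn.congr_fun this (fun x hx => ?_) measurableSet_Ioi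
  simp [gu_eq t s hx]

/-- The Fubini kernel. -/
def gk (c x y : ℝ) : ℝ := if c < y ∧ y ≤ x then 1 else if x < y ∧ y ≤ c then -1 else 0

lemma gk_measurable (c : ℝ) : Measurable (fun z : ℝ × ℝ => gk c z.1 z.2) := by
  unfold gk
  refine Measurable.ite ?_ measurable_const (Measurable.ite ?_ measurable_const measurable_const)
  · exact (measurableSet_lt measurable_const measurable_snd).inter
      (measurableSet_le measurable_snd measurable_fst)
  · exact (measurableSet_lt measurable_fst measurable_snd).inter
      (measurableSet_le measurable_snd measurable_const)

lemma gk_sign {t s : ℝ} (ht : 0 < t) {x y : ℝ} (hx : 0 < x) :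
    |gk (s / t) x y * gu t s x| = - (gk (s / t) x y * gu t s x) := by
  have hp := gw_pos t s hx
  apply abs_of_nonpos
  unfold gk gu
  split_ifs with h1 h2
  · have : s < t * x := by
      have := lt_of_lt_of_le h1.1 h1.2
      rw [div_lt_iff₀ ht] at this; linarith
    nlinarith
  · have : t * x < s := by
      have := lt_of_lt_of_le h2.1 h2.2
      rw [lt_div_iff₀ ht] at this; linarith
    nlinarith
  · simp

lemma gk_integral {t s : ℝ} (ht : 0 < t) (hs : 0 < s) {y : ℝ} (hy : 0 < y) :
    IntegrableOn (fun x => gk (s / t) x y * gu t s x) (Set.Ioi 0) ∧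
    ∫ x in Set.Ioi 0, gk (s / t) x y * gu t s x = - gw t (s + 1) y := by
  have hui := gu_integrableOn ht hs
  by_cases h : s / t < y
  · have e : (fun x => gk (s / t) x y * gu t s x) = (Set.Ici y).indicator (gu t s) := by
      ext x
      unfold gk
      by_cases hx : y ≤ x
      · simp [h, hx]
      · simp [h, hx]
    rw [e]
    refine ⟨hui.indicator measurableSet_Ici, ?_⟩
    rw [setIntegral_indicator measurableSet_Ici]
    have : Set.Ioi 0 ∩ Set.Ici y = Set.Ici y := by
      ext x; simp; intro h; linarith
    rw [this, integral_Ici_eq_integral_Ioi]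
    rw [integral_Ioi_of_hasDerivAt_of_tendsto (f := gw t (s + 1)) (m := 0)]
    · ring
    · exact (gw_hasDerivAt t s hy).continuousAt.continuousWithinAt
    · intro x hx
      exact gw_hasDerivAt t s (lt_trans hy hx)
    · exact hui.mono_set (fun x hx => lt_trans hy hx)
    · exact gw_tendsto ht _
  · push Not at h
    have e : (fun x => gk (s / t) x y * gu t s x) = (Set.Iio y).indicator (fun x => - gu t s x) := by
      ext x
      unfold gk
      have h' : ¬ (s / t < y) := not_lt.2 h
      by_cases hx : x < y
      · simp [h, h', hx]
      · simp [h, h', hx]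
    rw [e]
    refine ⟨hui.neg.indicator measurableSet_Iio, ?_⟩
    rw [setIntegral_indicator measurableSet_Iio]
    have : Set.Ioi 0 ∩ Set.Iio y = Set.Ioo 0 y := rfl
    rw [this, integral_neg, ← integral_Ioc_eq_integral_Ioo,
      ← intervalIntegral.integral_of_le hy.le]
    rw [intervalIntegral.integral_eq_sub_of_hasDerivAt_of_le (f := gw t (s + 1)) hy.le]
    · simp [gw, Real.zero_rpow hs.ne']
    · unfold gw
      apply ContinuousOn.mul
      · exact ContinuousOn.rpow_const continuousOn_id (fun x hx => Or.inr (by linarith))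
      · fun_prop
    · intro x hx
      exact gw_hasDerivAt t s hx.1
    · rw [intervalIntegrable_iff_integrableOn_Ioc_of_le hy.le]
      exact hui.mono_set (fun x hx => hx.1)

abbrev lam : Measure ℝ := volume.restrict (Set.Ioi 0)

lemma gk_prod_integrable {t s : ℝ} (ht : 0 < t) (hs : 0 < s) (h : ℝ → ℝ)
    (hm : AEStronglyMeasurable h lam)
    (hi : Integrable (fun y => gw t (s + 1) y * h y) lam) :
    Integrable (fun z : ℝ × ℝ => gk (s / t) z.1 z.2 * gu t s z.1 * h z.2) (lam.prod lam) := by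
  rw [integrable_prod_iff']
  · constructor
    · filter_upwards [ae_restrict_mem measurableSet_Ioi] with y hy
      exact ((gk_integral ht hs hy).1).mul_const _
    · refine hi.norm.congr ?_
      filter_upwards [ae_restrict_mem measurableSet_Ioi] with y hy
      have : ∫ x in Set.Ioi 0, ‖gk (s / t) x y * gu t s x * h y‖ =
          ∫ x in Set.Ioi 0, (- (gk (s / t) x y * gu t s x)) * ‖h y‖ := by
        apply setIntegral_congr_fun measurableSet_Ioi
        intro x hx
        simp only
        rw [norm_mul, Real.norm_eq_abs (_ * _), gk_sign ht hx]
      rw [this, integral_mul_const, integral_neg, (gk_integral ht hs hy).2, norm_mul,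
        Real.norm_eq_abs (gw _ _ _), abs_of_pos (gw_pos _ _ hy), neg_neg]
  · apply AEStronglyMeasurable.mul
    · exact ((gk_measurable _).mul ((gu_measurable t s).comp measurable_fst)).aestronglyMeasurable
    · exact hm.comp_snd

/-- `g` is locally absolutely continuous on `(0,∞)` with derivative `h`. -/
def ACp (g h : ℝ → ℝ) : Prop := ∀ x > 0, ∀ y > 0, IntervalIntegrable h volume x y ∧
  g y - g x = ∫ z in x..y, h z

lemma ACp.locInt {g h : ℝ → ℝ} (H : ACp g h) : LocallyIntegrableOn h (Set.Ioi 0) := by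
  intro x hx
  refine ⟨Set.Ioc (x / 2) (2 * x), mem_nhdsWithin_of_mem_nhds ?_, ?_⟩
  · have hx : 0 < x := hx
    exact Ioc_mem_nhds (by linarith) (by linarith)
  · have hx : 0 < x := hx
    have := (H (x / 2) (by positivity) (2 * x) (by positivity)).1
    rwa [intervalIntegrable_iff_integrableOn_Ioc_of_le (by linarith)] at this

lemma ACp.aesm {g h : ℝ → ℝ} (H : ACp g h) : AEStronglyMeasurable h lam :=
  H.locInt.aestronglyMeasurable

lemma gk_int_eq {c x : ℝ} (hc : 0 < c) (hx : 0 < x) (h : ℝ → ℝ) :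
    ∫ y in Set.Ioi 0, gk c x y * h y = ∫ y in c..x, h y := by
  rcases le_total c x with hcx | hcx
  · rw [intervalIntegral.integral_of_le hcx]
    have : (fun y => gk c x y * h y) = (Set.Ioc c x).indicator h := by
      ext y
      unfold gk
      by_cases hy : c < y ∧ y ≤ x
      · simp [hy]
      · have : ¬ (x < y ∧ y ≤ c) := fun h => by linarith [h.1, h.2]
        rw [if_neg hy, if_neg this, Set.indicator_of_notMem (by simpa using hy)]; simp
    rw [this, setIntegral_indicator measurableSet_Ioc]
    congr 2
    ext y; simp; intro h1 _; linarith
  · rw [intervalIntegral.integral_of_ge hcx, ← integral_neg]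
    have : (fun y => gk c x y * h y) = (Set.Ioc x c).indicator (fun y => - h y) := by
      ext y
      unfold gk
      have h1 : ¬ (c < y ∧ y ≤ x) := fun h => by linarith [h.1, h.2]
      by_cases hy : x < y ∧ y ≤ c
      · rw [if_neg h1, if_pos hy, Set.indicator_of_mem (by simpa using hy)]; simp
      · rw [if_neg h1, if_neg hy, Set.indicator_of_notMem (by simpa using hy)]; simp
    rw [this, setIntegral_indicator measurableSet_Ioc]
    congr 2
    ext y; simp; intro h1 _; linarith

lemma ACp.continuousOn {g h : ℝ → ℝ} (H : ACp g h) : ContinuousOn g (Set.Ioi 0) := by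
  intro x hx
  have hx : 0 < x := hx
  apply ContinuousAt.continuousWithinAt
  have h1 : ContinuousOn (fun y => ∫ z in (x/2)..y, h z) (Set.uIcc (x / 2) (2 * x)) := 
    intervalIntegral.continuousOn_primitive_interval'
      (H (x / 2) (by positivity) (2 * x) (by positivity)).1 (by simp)
  have hn : Set.uIcc (x / 2) (2 * x) ∈ nhds x := by
    rw [Set.uIcc_of_le (by linarith)]
    exact Icc_mem_nhds (by linarith) (by linarith)
  have h2 := (h1.continuousAt hn).add_const (g (x / 2))
  refine h2.congr ?_
  filter_upwards [lt_mem_nhds hx] with y hy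
  rw [← (H (x / 2) (by positivity) y hy).2]; ring

lemma ae_lam_pos : ∀ᵐ x ∂lam, 0 < x := ae_restrict_mem measurableSet_Ioi

/-- Integration by parts against `gw t (s+1)`. -/
lemma ACp.ibp {g h : ℝ → ℝ} (H : ACp g h) {t s : ℝ} (ht : 0 < t) (hs : 0 < s)
    (hi : Integrable (fun y => gw t (s + 1) y * h y) lam) :
    Integrable (fun x => gw t s x * g x) lam ∧ Integrable (fun x => gw t (s + 1) x * g x) lam ∧
    ∫ x, gw t (s + 1) x * h x ∂lam =
      t * ∫ x, gw t (s + 1) x * g x ∂lam - s * ∫ x, gw t s x * g x ∂lam := by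
  have hc : 0 < s / t := by positivity
  set c := s / t with hcdef
  have hp := gk_prod_integrable ht hs h H.aesm hi
  rw [← hcdef] at hp
  have e1 : ∀ x > 0, ∫ y in Set.Ioi 0, gk c x y * gu t s x * h y = (g x - g c) * gu t s x := by
    intro x hx
    have : ∀ y, gk c x y * gu t s x * h y = gu t s x * (gk c x y * h y) := fun y => by ring
    simp only [this]
    rw [integral_const_mul, gk_int_eq hc hx, (H c hc x hx).2]; ring
  have i1 : Integrable (fun x => (g x - g c) * gu t s x) lam := by
    refine hp.integral_prod_left.congr ?_
    filter_upwards [ae_lam_pos] with x hx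
    exact e1 x hx
  have hu : Integrable (gu t s) lam := gu_integrableOn ht hs
  have i2 : Integrable (fun x => gu t s x * g x) lam := by
    refine (i1.add (hu.const_mul (g c))).congr ?_
    filter_upwards with x
    simp; ring
  have hgm : AEStronglyMeasurable g lam :=
    H.continuousOn.aestronglyMeasurable measurableSet_Ioi
  have hi0 : Integrable (fun x => gw t s x * g x) lam := by
    have hloc : IntegrableOn (fun x => gw t s x * g x) (Set.Icc (c / 2) (2 * c)) := by
      apply ContinuousOn.integrableOn_Icc
      refine ((gw_continuousOn t s).mul H.continuousOn).mono ?_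
      intro x hx
      have : c / 2 ≤ x := hx.1
      show 0 < x
      linarith
    have hloc' : Integrable ((Set.Icc (c / 2) (2 * c)).indicator
        (fun x => ‖gw t s x * g x‖)) lam := by
      refine IntegrableOn.integrable_indicator ?_ measurableSet_Icc
      exact (hloc.norm).mono_measure (Measure.restrict_mono le_rfl Measure.restrict_le_self)
    refine ((i2.norm.const_mul (2 / s)).add hloc').mono' 
      ((gw_measurable t s).aestronglyMeasurable.mul hgm) ?_
    filter_upwards [ae_lam_pos] with x hx
    by_cases hx2 : x ∈ Set.Icc (c / 2) (2 * c)
    · simp only [Pi.add_apply, Set.indicator_of_mem hx2]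
      have : 0 ≤ 2 / s * ‖gu t s x * g x‖ := by positivity
      linarith
    · simp only [Pi.add_apply, Set.indicator_of_notMem hx2, add_zero]
      have key : s / 2 ≤ |s - t * x| := by
        have htc : t * c = s := by rw [hcdef]; field_simp
        by_cases h1 : x < c / 2
        · have : t * x ≤ t * (c / 2) := by gcongr
          rw [le_abs]; left; linarith
        · have h3 : 2 * c < x := by
            by_contra h4
            exact hx2 ⟨not_lt.1 h1, not_lt.1 h4⟩
          have : t * (2 * c) ≤ t * x := by gcongr
          rw [le_abs]; right; linarith
      have hw := gw_pos t s hx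
      rw [gu, norm_mul, norm_mul, norm_mul, Real.norm_eq_abs (s - t * x)]
      have h0 : 0 ≤ ‖gw t s x‖ * ‖g x‖ := by positivity
      calc ‖gw t s x‖ * ‖g x‖ = 2 / s * (s / 2 * (‖gw t s x‖ * ‖g x‖)) := by field_simp
        _ ≤ 2 / s * (|s - t * x| * (‖gw t s x‖ * ‖g x‖)) := by gcongr
        _ = _ := by ring
  have hi1 : Integrable (fun x => gw t (s + 1) x * g x) lam := by
    refine (((hi0.const_mul s).sub i2).const_mul (1 / t)).congr ?_
    filter_upwards [ae_lam_pos] with x hx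
    simp only [Pi.sub_apply]
    rw [gu_eq t s hx]; field_simp; ring
  refine ⟨hi0, hi1, ?_⟩
  have hsw := integral_integral_swap (μ := lam) (ν := lam)
    (f := fun x y => gk c x y * gu t s x * h y) hp
  have l1 : ∫ x, ∫ y, gk c x y * gu t s x * h y ∂lam ∂lam = ∫ x, gu t s x * g x ∂lam := by
    have : ∫ x, ∫ y, gk c x y * gu t s x * h y ∂lam ∂lam
        = ∫ x, gu t s x * g x - g c * gu t s x ∂lam := by
      apply integral_congr_ae
      filter_upwards [ae_lam_pos] with x hx
      rw [e1 x hx]; ring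
    rw [this, integral_sub i2 (hu.const_mul _), integral_const_mul]
    have hu0 : ∫ x, gu t s x ∂lam = 0 := by
      have : ∫ x, gu t s x ∂lam = ∫ x, s * gw t s x - t * gw t (s + 1) x ∂lam := by
        apply integral_congr_ae
        filter_upwards [ae_lam_pos] with x hx
        rw [gu_eq t s hx]
      have hs1 : 0 < s + 1 := by linarith
      rw [this, integral_sub ((gw_integrableOn ht hs).const_mul s)
        ((gw_integrableOn ht hs1).const_mul t), integral_const_mul, integral_const_mul,
        gw_integral ht hs, gw_integral ht hs1, Real.Gamma_add_one hs.ne',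
        Real.rpow_add ht, Real.rpow_one]
      field_simp; ring
    rw [hu0]; ring
  have l2 : ∫ y, ∫ x, gk c x y * gu t s x * h y ∂lam ∂lam = - ∫ x, gw t (s + 1) x * h x ∂lam := by
    rw [← integral_neg]
    apply integral_congr_ae
    filter_upwards [ae_lam_pos] with y hy
    rw [integral_mul_const, (gk_integral ht hs hy).2]; ring
  rw [l1, l2] at hsw
  have l3 : ∫ x, gu t s x * g x ∂lam = s * ∫ x, gw t s x * g x ∂lam
      - t * ∫ x, gw t (s + 1) x * g x ∂lam := by
    rw [← integral_const_mul, ← integral_const_mul, 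
      ← integral_sub (hi0.const_mul s) (hi1.const_mul t)]
    apply integral_congr_ae
    filter_upwards [ae_lam_pos] with x hx
    rw [gu_eq t s hx]; ring
  linarith

lemma interval_cs {h : ℝ → ℝ} {c x : ℝ} (h1 : IntervalIntegrable h volume c x)
    (h2 : IntervalIntegrable (fun y => h y ^ 2) volume c x) :
    (∫ y in c..x, h y) ^ 2 ≤ (x - c) * ∫ y in c..x, h y ^ 2 := by
  wlog hcx : c ≤ x generalizing c x
  · have := this h1.symm h2.symm (le_of_not_ge hcx)
    rw [intervalIntegral.integral_symm c x, intervalIntegral.integral_symm c x] at this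
    nlinarith
  rcases hcx.eq_or_lt with rfl | hlt
  · simp
  set I := ∫ y in c..x, h y
  have hpos : 0 < x - c := by linarith
  have key : 0 ≤ ∫ y in c..x, (h y ^ 2 - 2 * (I / (x - c)) * h y + (I / (x - c)) ^ 2) := by
    apply intervalIntegral.integral_nonneg hcx
    intro u _
    nlinarith [sq_nonneg (h u - I / (x - c))]
  rw [intervalIntegral.integral_add (h2.sub (h1.const_mul _)) (by simp),
    intervalIntegral.integral_sub h2 (h1.const_mul _), intervalIntegral.integral_const_mul,
    intervalIntegral.integral_const, smul_eq_mul] at key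
  have e : ∫ y in c..x, h y ^ 2 ≥ I ^ 2 / (x - c) := by
    have : (x - c) * (I / (x - c)) ^ 2 = I ^ 2 / (x - c) := by field_simp
    have h3 : 2 * (I / (x - c)) * I = 2 * (I ^ 2 / (x - c)) := by field_simp
    change 0 ≤ (∫ y in c..x, h y ^ 2) - 2 * (I / (x - c)) * I + _ at key
    linarith
  have := mul_le_mul_of_nonneg_left e hpos.le
  rwa [mul_div_cancel₀ _ hpos.ne'] at this

/-- Cacoullos-type inequality: square integrability passes down. -/
lemma ACp.l2 {g h : ℝ → ℝ} (H : ACp g h) {t s : ℝ} (ht : 0 < t) (hs : 0 < s)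
    (hi : Integrable (fun y => gw t (s + 1) y * h y ^ 2) lam) :
    Integrable (fun x => gw t s x * g x ^ 2) lam := by
  have hc : 0 < s / t := by positivity
  set c := s / t with hcdef
  have htc : t * c = s := by rw [hcdef]; field_simp
  have hp := gk_prod_integrable ht hs (fun y => h y ^ 2) (H.aesm.pow 2) hi
  rw [← hcdef] at hp
  have hgm : AEStronglyMeasurable g lam :=
    H.continuousOn.aestronglyMeasurable measurableSet_Ioi
  have e1 : ∀ x > 0, ∫ y in Set.Ioi 0, gk c x y * gu t s x * h y ^ 2 =
      gu t s x * ∫ y in c..x, h y ^ 2 := by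
    intro x hx
    have : ∀ y, gk c x y * gu t s x * h y ^ 2 = gu t s x * (gk c x y * h y ^ 2) := fun y => by ring
    simp only [this]
    rw [integral_const_mul, gk_int_eq hc hx]
  have hsq : ∀ x > 0, IntervalIntegrable (fun y => h y ^ 2) volume c x := by
    intro x hx
    have hsub : Set.uIcc c x ⊆ Set.Ioi 0 := by
      intro y hy
      have := hy.1
      exact lt_of_lt_of_le (lt_min hc hx) this
    have hi2 : IntegrableOn (fun y => gw t (s + 1) y * h y ^ 2) (Set.uIoc c x) :=
      IntegrableOn.mono_set (t := Set.Ioi 0) hi (Set.uIoc_subset_uIcc.trans hsub)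
    have hcont : ContinuousOn (fun y => (gw t (s + 1) y)⁻¹) (Set.uIcc c x) :=
      ((gw_continuousOn t (s + 1)).mono hsub).inv₀ (fun y hy => (gw_pos _ _ (hsub hy)).ne')
    have := (intervalIntegrable_iff.2 hi2).continuousOn_mul hcont
    refine this.congr ?_
    intro y hy
    have := gw_pos t (s + 1) (hsub (Set.uIoc_subset_uIcc hy))
    simp only
    field_simp
  have i1 : Integrable (fun x => gw t s x * (g x - g c) ^ 2) lam := by
    refine (hp.integral_prod_left.norm.const_mul (1 / t)).mono'
      ((gw_measurable t s).aestronglyMeasurable.mul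
        ((hgm.sub aestronglyMeasurable_const).pow 2)) ?_
    filter_upwards [ae_lam_pos] with x hx
    change _ ≤ 1 / t * ‖∫ y in Set.Ioi 0, gk c x y * gu t s x * h y ^ 2‖
    rw [e1 x hx, (H c hc x hx).2]
    have hw := gw_pos t s hx
    have cs := interval_cs (H c hc x hx).1 (hsq x hx)
    rw [Real.norm_eq_abs, abs_of_nonneg (by positivity)]
    calc gw t s x * (∫ y in c..x, h y) ^ 2 ≤ gw t s x * ((x - c) * ∫ y in c..x, h y ^ 2) := by
          gcongr
      _ = 1 / t * (-(gu t s x * ∫ y in c..x, h y ^ 2)) := by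
          rw [gu, ← htc]; field_simp; ring
      _ ≤ _ := by
          gcongr
          exact neg_le_abs _
  have hw : Integrable (gw t s) lam := gw_integrableOn ht hs
  refine ((i1.const_mul 2).add (hw.const_mul (2 * g c ^ 2))).mono'
    ((gw_measurable t s).aestronglyMeasurable.mul (hgm.pow 2)) ?_
  filter_upwards [ae_lam_pos] with x hx
  have hw := gw_pos t s hx
  rw [Real.norm_eq_abs, abs_of_nonneg (by positivity)]
  simp only [Pi.add_apply]
  have : g x ^ 2 ≤ 2 * (g x - g c) ^ 2 + 2 * g c ^ 2 := by
    nlinarith [sq_nonneg (g x - 2 * g c)]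
  nlinarith

/-- All moments of order up to `d` exist. -/
def Mom (t s : ℝ) (f : ℝ → ℝ) (d : ℕ) : Prop :=
  ∀ j ≤ d, Integrable (fun x => gw t (s + j) x * f x) lam

lemma mom_of_l2 {t s : ℝ} (ht : 0 < t) (hs : 0 < s) {f : ℝ → ℝ} (hf : AEStronglyMeasurable f lam)
    (hi : Integrable (fun y => gw t s y * f y ^ 2) lam) (d : ℕ) : Mom t s f d := by
  intro j _
  have hw : Integrable (gw t (s + (2 * j : ℕ))) lam := gw_integrableOn ht (by positivity)
  refine (hi.add hw).mono' ((gw_measurable t _).aestronglyMeasurable.mul hf) ?_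
  filter_upwards [ae_lam_pos] with x hx
  have hw := gw_pos t s hx
  simp only [Pi.add_apply]
  rw [gw_add_nat t s _ hx, gw_add_nat t s _ hx, Real.norm_eq_abs, abs_mul, abs_mul,
    abs_of_pos hw, abs_of_pos (pow_pos hx j)]
  have : x ^ j * |f x| ≤ f x ^ 2 + x ^ (2 * j) := by
    have := sq_nonneg (x ^ j - |f x|)
    have h2 : x ^ (2 * j) = (x ^ j) ^ 2 := by rw [mul_comm, pow_mul]
    rw [h2, ← sq_abs (f x)]
    nlinarith [sq_nonneg (x ^ j), sq_nonneg (|f x|)]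
  nlinarith

lemma ACp.mom_step {g h : ℝ → ℝ} (H : ACp g h) {t s : ℝ} (ht : 0 < t) (hs : 0 < s) {d : ℕ}
    (hh : Mom t (s + 1) h d) : Mom t s g (d + 1) := by
  intro j hj
  rcases Nat.lt_or_ge j (d + 1) with h1 | h1
  · have := hh j (by omega)
    rw [show s + 1 + (j : ℝ) = (s + j) + 1 by ring] at this
    exact (H.ibp ht (by positivity) this).1
  · obtain rfl : j = d + 1 := by omega
    have := hh d le_rfl
    rw [show s + 1 + (d : ℝ) = (s + d) + 1 by ring] at this
    have := (H.ibp ht (by positivity) this).2.1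
    push_cast
    rwa [← add_assoc]

open Polynomial in
lemma pair_eq {t s : ℝ} {f : ℝ → ℝ} {d : ℕ} (hf : Mom t s f d) (p : ℝ[X]) (hp : p.natDegree ≤ d) :
    Integrable (fun x => gw t s x * f x * p.eval x) lam ∧
    ∫ x, gw t s x * f x * p.eval x ∂lam =
      ∑ j ∈ range (d + 1), p.coeff j * ∫ x, gw t (s + j) x * f x ∂lam := by
  have e : ∀ x > 0, gw t s x * f x * p.eval x =
      ∑ j ∈ range (d + 1), p.coeff j * (gw t (s + j) x * f x) := by
    intro x hx
    rw [Polynomial.eval_eq_sum_range' (Nat.lt_succ_of_le hp), Finset.mul_sum]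
    apply Finset.sum_congr rfl
    intro j _
    rw [gw_add_nat t s j hx]; ring
  have hi : ∀ j ∈ range (d + 1),
      Integrable (fun x => p.coeff j * (gw t (s + j) x * f x)) lam := fun j hj =>
    (hf j (by simp at hj; omega)).const_mul _
  constructor
  · refine (integrable_finsetSum _ hi).congr ?_
    filter_upwards [ae_lam_pos] with x hx
    rw [e x hx]
  · have : ∫ x, gw t s x * f x * p.eval x ∂lam =
        ∫ x, ∑ j ∈ range (d + 1), p.coeff j * (gw t (s + j) x * f x) ∂lam := by
      apply integral_congr_ae
      filter_upwards [ae_lam_pos] with x hx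
      rw [e x hx]
    rw [this, integral_finsetSum _ hi]
    simp only [integral_const_mul]

open Polynomial in
/-- The raising operator. -/
def Aop (t s : ℝ) (p : ℝ[X]) : ℝ[X] := C t * (X * p) - C s * p - X * derivative p

open Polynomial in
lemma Aop_natDegree (t s : ℝ) (p : ℝ[X]) {d : ℕ} (hp : p.natDegree ≤ d) :
    (Aop t s p).natDegree ≤ d + 1 := by
  unfold Aop
  have h1 : (X * p).natDegree ≤ d + 1 := by
    refine (natDegree_mul_le).trans ?_
    have := natDegree_X_le (R := ℝ); omega
  have h2 : (X * derivative p).natDegree ≤ d + 1 := by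
    refine (natDegree_mul_le).trans ?_
    have := natDegree_X_le (R := ℝ)
    have := natDegree_derivative_le p; omega
  have h3 : (C t * (X * p)).natDegree ≤ d + 1 := (natDegree_C_mul_le _ _).trans h1
  have h4 : (C s * p).natDegree ≤ d + 1 := (natDegree_C_mul_le _ _).trans (by omega)
  refine (natDegree_sub_le _ _).trans (max_le ((natDegree_sub_le _ _).trans (max_le h3 h4)) h2)

open Polynomial in
lemma Aop_coeff_zero (t s : ℝ) (p : ℝ[X]) : (Aop t s p).coeff 0 = - s * p.coeff 0 := by
  simp [Aop]

open Polynomial in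
lemma Aop_coeff_succ (t s : ℝ) (p : ℝ[X]) (j : ℕ) :
    (Aop t s p).coeff (j + 1) = t * p.coeff j - (s + (j + 1 : ℕ)) * p.coeff (j + 1) := by
  simp [Aop, coeff_X_mul, coeff_derivative]; ring

open Polynomial in
lemma ACp.adj {g h : ℝ → ℝ} (H : ACp g h) {t s : ℝ} (ht : 0 < t) (hs : 0 < s) {d : ℕ}
    (hh : Mom t (s + 1) h d) (p : ℝ[X]) (hp : p.natDegree ≤ d) :
    ∫ x, gw t (s + 1) x * h x * p.eval x ∂lam = ∫ x, gw t s x * g x * (Aop t s p).eval x ∂lam := by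
  rw [(pair_eq hh p hp).2, (pair_eq (H.mom_step ht hs hh) _ (Aop_natDegree t s p hp)).2]
  rw [Finset.sum_range_succ' _ (d + 1), Aop_coeff_zero]
  have e : ∀ j ∈ range (d + 1), p.coeff j * ∫ x, gw t (s + 1 + j) x * h x ∂lam =
      p.coeff j * t * (∫ x, gw t (s + (j + 1 : ℕ)) x * g x ∂lam)
        - p.coeff j * (s + j) * ∫ x, gw t (s + j) x * g x ∂lam := by
    intro j hj
    have := hh j (by simp at hj; omega)
    rw [show s + 1 + (j : ℝ) = (s + j) + 1 by ring] at this
    have := (H.ibp ht (by positivity) this).2.2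
    rw [show s + 1 + (j : ℝ) = (s + j) + 1 by ring, this]
    push_cast
    rw [← add_assoc]; ring
  rw [Finset.sum_congr rfl e, Finset.sum_sub_distrib]
  simp only [Aop_coeff_succ, sub_mul, Finset.sum_sub_distrib]
  have hz : p.coeff (d + 1) = 0 := coeff_eq_zero_of_natDegree_lt (by omega)
  have k1 := Finset.sum_range_succ' (fun j : ℕ => p.coeff j * (s + j) *
    ∫ x, gw t (s + j) x * g x ∂lam) (d + 1)
  rw [Finset.sum_range_succ, hz] at k1
  simp only [zero_mul, add_zero] at k1
  rw [k1]
  simp only [mul_comm t, mul_comm (s + _) (p.coeff _)]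
  simp
  ring

open Polynomial in
/-- Unnormalised Laguerre polynomials. -/
def gQ (t : ℝ) : ℕ → ℝ → ℝ[X]
  | 0, _ => 1
  | k + 1, s => Aop t s (gQ t k (s + 1))

open Polynomial in
lemma gQ_natDegree (t : ℝ) (k : ℕ) : ∀ s, (gQ t k s).natDegree ≤ k := by
  induction k with
  | zero => intro s; simp [gQ]
  | succ k ih => intro s; exact Aop_natDegree t s _ (ih (s + 1))

open Polynomial in
lemma gQ_coeff (t : ℝ) (k : ℕ) : ∀ s, (gQ t k s).coeff k = t ^ k := by
  induction k with
  | zero => intro s; simp [gQ]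
  | succ k ih =>
    intro s
    rw [gQ, Aop_coeff_succ, ih, coeff_eq_zero_of_natDegree_lt
      (lt_of_le_of_lt (gQ_natDegree t k _) (Nat.lt_succ_self k))]
    ring

lemma gQ_chain {t : ℝ} (ht : 0 < t) (i : ℕ) : ∀ (G : ℕ → ℝ → ℝ) (s : ℝ), 0 < s →
    (∀ k < i, ACp (G k) (G (k + 1))) → ∀ k, Mom t (s + i) (G i) k →
    Mom t s (G 0) (k + i) ∧
    ∫ x, gw t (s + i) x * G i x * (gQ t k (s + i)).eval x ∂lam =
      ∫ x, gw t s x * G 0 x * (gQ t (k + i) s).eval x ∂lam := by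
  induction i with
  | zero => intro G s hs _ k hm; simpa using hm
  | succ i ih =>
    intro G s hs hG k hm
    have e : s + ((i + 1 : ℕ) : ℝ) = (s + 1) + i := by push_cast; ring
    rw [e] at hm ⊢
    obtain ⟨h1, h2⟩ := ih (fun k => G (k + 1)) (s + 1) (by linarith)
      (fun k hk => hG (k + 1) (by omega)) k hm
    have H := hG 0 (by omega)
    refine ⟨H.mom_step ht hs h1, ?_⟩
    rw [h2]
    exact H.adj ht hs h1 _ (gQ_natDegree t _ _)

open Polynomial in
lemma ACp_poly (p : ℝ[X]) : ACp (fun x => p.eval x) (fun x => (derivative p).eval x) := by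
  intro x _ y _
  have hc : Continuous (fun x => (derivative p).eval x) := (derivative p).continuous
  refine ⟨hc.intervalIntegrable _ _, ?_⟩
  rw [intervalIntegral.integral_eq_sub_of_hasDerivAt (fun z _ => p.hasDerivAt z)
    (hc.intervalIntegrable _ _)]

open Polynomial in
lemma mom_poly {t s : ℝ} (ht : 0 < t) (hs : 0 < s) (p : ℝ[X]) (d : ℕ) :
    Mom t s (fun x => p.eval x) d := by
  intro j _
  have h1 : Mom t s (fun _ => 1) (p * X ^ j).natDegree := by
    intro i _
    simp only [mul_one]
    exact gw_integrableOn (s := s + i) ht (by positivity)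
  refine (pair_eq h1 _ le_rfl).1.congr ?_
  filter_upwards [ae_lam_pos] with x hx
  rw [gw_add_nat t s j hx]; simp; ring

open Polynomial in
lemma gQ_poly {t s : ℝ} (ht : 0 < t) (hs : 0 < s) (p : ℝ[X]) (k : ℕ) :
    ∫ x, gw t s x * p.eval x * (gQ t k s).eval x ∂lam =
      ∫ x, gw t (s + k) x * (derivative^[k] p).eval x ∂lam := by
  have := (gQ_chain ht k (fun i x => (derivative^[i] p).eval x) s hs
    (fun i _ => by
      have := ACp_poly (derivative^[i] p)
      simp only [Function.iterate_succ_apply']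
      exact this) 0 (mom_poly ht (by positivity) _ _)).2
  simp [gQ] at this
  simpa using this.symm

open Polynomial in
lemma gQ_poly_zero {t s : ℝ} (ht : 0 < t) (hs : 0 < s) (p : ℝ[X]) (k : ℕ) (hp : p.natDegree < k) :
    ∫ x, gw t s x * p.eval x * (gQ t k s).eval x ∂lam = 0 := by
  rw [gQ_poly ht hs, iterate_derivative_eq_zero hp]; simp

/-- Squared norms. -/
def gN (t s : ℝ) (k : ℕ) : ℝ := k.factorial * Real.Gamma (s + k) / t ^ s

lemma gN_pos {t s : ℝ} (ht : 0 < t) (hs : 0 < s) (k : ℕ) : 0 < gN t s k := by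
  unfold gN
  have := Real.Gamma_pos_of_pos (by positivity : 0 < s + k)
  positivity

open Polynomial in
lemma gQ_norm {t s : ℝ} (ht : 0 < t) (hs : 0 < s) (k : ℕ) :
    ∫ x, gw t s x * (gQ t k s).eval x * (gQ t k s).eval x ∂lam = gN t s k := by
  rw [gQ_poly ht hs]
  have e : derivative^[k] (gQ t k s) = C (k.factorial * t ^ k) := by
    have hd : (derivative^[k] (gQ t k s)).natDegree ≤ 0 := by
      have := natDegree_iterate_derivative (gQ t k s) k
      have := gQ_natDegree t k s
      omega
    rw [eq_C_of_natDegree_le_zero hd, coeff_iterate_derivative]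
    simp [gQ_coeff, Nat.descFactorial_self]
  rw [e]
  simp only [eval_C]
  rw [integral_mul_const, gw_integral ht (by positivity), gN, Real.rpow_add ht, Real.rpow_natCast]
  field_simp

lemma gQ_orth {t s : ℝ} (ht : 0 < t) (hs : 0 < s) {j k : ℕ} (hjk : j ≠ k) :
    ∫ x, gw t s x * (gQ t j s).eval x * (gQ t k s).eval x ∂lam = 0 := by
  rcases lt_or_gt_of_ne hjk with h | h
  · exact gQ_poly_zero ht hs _ _ (lt_of_le_of_lt (gQ_natDegree t j s) h)
  · rw [← gQ_poly_zero ht hs (gQ t k s) j (lt_of_le_of_lt (gQ_natDegree t k s) h)]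
    congr 1; ext x; ring

/-- The unnormalised gamma measure. -/
def gmu (t s : ℝ) : Measure ℝ := lam.withDensity (fun x => ENNReal.ofReal (gw t s x))

lemma gmu_integral (t s : ℝ) (f : ℝ → ℝ) : ∫ x, f x ∂(gmu t s) = ∫ x, gw t s x * f x ∂lam := by
  rw [gmu, integral_withDensity_eq_integral_toReal_smul (gw_measurable t s).ennreal_ofReal
    (by simp)]
  apply integral_congr_ae
  filter_upwards [ae_lam_pos] with x hx
  rw [ENNReal.toReal_ofReal (gw_pos t s hx).le, smul_eq_mul]

lemma gmu_integrable (t s : ℝ) (f : ℝ → ℝ) :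
    Integrable f (gmu t s) ↔ Integrable (fun x => gw t s x * f x) lam := by
  rw [gmu, integrable_withDensity_iff_integrable_smul' (gw_measurable t s).ennreal_ofReal
    (by simp)]
  apply integrable_congr
  filter_upwards [ae_lam_pos] with x hx
  rw [ENNReal.toReal_ofReal (gw_pos t s hx).le, smul_eq_mul]

lemma gmu_memLp (t s : ℝ) {f : ℝ → ℝ} (hf : AEStronglyMeasurable f lam)
    (hi : Integrable (fun x => gw t s x * f x ^ 2) lam) : MemLp f 2 (gmu t s) := by
  rw [memLp_two_iff_integrable_sq, gmu_integrable]
  · exact hi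
  · exact hf.mono_ac (withDensity_absolutelyContinuous _ _)

open Polynomial in
lemma poly_l2 {t s : ℝ} (ht : 0 < t) (hs : 0 < s) (p : ℝ[X]) :
    Integrable (fun x => gw t s x * p.eval x ^ 2) lam := by
  have := mom_poly ht hs (p ^ 2) 0 0 le_rfl
  simpa using this

open Polynomial in
lemma all_poly_zero {t s : ℝ} (ht : 0 < t) (f : ℝ → ℝ)
    (hm : ∀ d, Mom t s f d)
    (h0 : ∀ k, ∫ x, gw t s x * f x * (gQ t k s).eval x ∂lam = 0) (d : ℕ) :
    ∀ p : ℝ[X], (∀ m ≥ d, p.coeff m = 0) → ∫ x, gw t s x * f x * p.eval x ∂lam = 0 := by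
  induction d with
  | zero =>
    intro p hp
    have : p = 0 := by ext m; simpa using hp m (Nat.zero_le _)
    simp [this]
  | succ d ih =>
    intro p hp
    have h1 := ih (p - C (p.coeff d / t ^ d) * gQ t d s) (by
      intro m hm
      rcases hm.lt_or_eq with h | h
      · rw [coeff_sub, hp m h, coeff_C_mul, coeff_eq_zero_of_natDegree_lt
          (lt_of_le_of_lt (gQ_natDegree t d s) h)]
        simp
      · subst h
        rw [coeff_sub, coeff_C_mul, gQ_coeff]
        field_simp; ring)
    have e : ∀ x, gw t s x * f x * (p - C (p.coeff d / t ^ d) * gQ t d s).eval x =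
        gw t s x * f x * p.eval x - p.coeff d / t ^ d * (gw t s x * f x * (gQ t d s).eval x) := by
      intro x; simp; ring
    simp only [e] at h1
    rw [integral_sub (pair_eq (hm _) p le_rfl).1 ((pair_eq (hm _) _ le_rfl).1.const_mul _),
      integral_const_mul, h0] at h1
    simpa using h1

open Polynomial in
/-- Completeness of the Laguerre polynomials. -/
lemma gQ_complete {t s : ℝ} (ht : 0 < t) (hs : 0 < s) (f : ℝ → ℝ)
    (hf : AEStronglyMeasurable f lam) (hi : Integrable (fun x => gw t s x * f x ^ 2) lam)
    (h0 : ∀ k, ∫ x, gw t s x * f x * (gQ t k s).eval x ∂lam = 0) : f =ᵐ[lam] 0 := by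
  have hm : ∀ d, Mom t s f d := mom_of_l2 ht hs hf hi
  have hpoly : ∀ p : ℝ[X], ∫ x, gw t s x * f x * p.eval x ∂lam = 0 := fun p =>
    all_poly_zero ht f hm h0 (p.natDegree + 1) p
      (fun m hm => coeff_eq_zero_of_natDegree_lt hm)
  have key : (fun x => gw t s x * f x) =ᵐ[lam] 0 := by
    refine gvb_moment_unique _ ((gw_measurable t s).aemeasurable.mul hf.aemeasurable) (t / 2)
      (by positivity) ?_ ?_ ?_
    · intro c hc
      have hw : Integrable (gw (t - 2 * c) s) lam :=
        gw_integrableOn (by linarith [hc.2]) hs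
      refine (hi.add hw).mono' 
        (((gw_measurable t _).aestronglyMeasurable.mul hf).mul (by fun_prop)) ?_
      filter_upwards [ae_lam_pos] with x hx
      have hw := gw_pos t s hx
      have e : gw (t - 2 * c) s x = gw t s x * (Real.exp (c * x)) ^ 2 := by
        unfold gw
        rw [mul_assoc, ← Real.exp_nat_mul, ← Real.exp_add]
        congr 2; push_cast; ring
      simp only [Pi.add_apply]
      rw [e, Real.norm_eq_abs, abs_mul, abs_mul, abs_of_pos hw, Real.abs_exp, ← sq_abs (f x)]
      have : |f x| * Real.exp (c * x) ≤ |f x| ^ 2 + Real.exp (c * x) ^ 2 := by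
        nlinarith [sq_nonneg (|f x| - Real.exp (c * x)), sq_nonneg (|f x|),
          sq_nonneg (Real.exp (c * x))]
      nlinarith
    · intro k
      simpa using (pair_eq (hm _) (X ^ k) le_rfl).1
    · intro k
      simpa using hpoly (X ^ k)
  filter_upwards [key, ae_lam_pos] with x hx hx0
  have := gw_pos t s hx0
  simpa [this.ne'] using hx

open Polynomial in
/-- The Parseval identity. -/
lemma gQ_parseval {t s : ℝ} (ht : 0 < t) (hs : 0 < s) (f : ℝ → ℝ)
    (hf : AEStronglyMeasurable f lam) (hi : Integrable (fun x => gw t s x * f x ^ 2) lam) :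
    HasSum (fun k => (∫ x, gw t s x * f x * (gQ t k s).eval x ∂lam) ^ 2 / gN t s k)
      (∫ x, gw t s x * f x ^ 2 ∂lam) := by
  have hQm : ∀ k, MemLp (fun x => (gQ t k s).eval x) 2 (gmu t s) := fun k =>
    gmu_memLp t s (gQ t k s).continuous.aestronglyMeasurable (poly_l2 ht hs _)
  have hq : ∃ q : ℕ → Lp ℝ 2 (gmu t s), ∀ k, q k =ᵐ[gmu t s] fun x => (gQ t k s).eval x :=
    ⟨fun k => (hQm k).toLp, fun k => (hQm k).coeFn_toLp⟩
  obtain ⟨q, hq⟩ := hq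
  set v : ℕ → Lp ℝ 2 (gmu t s) := fun k => (Real.sqrt (gN t s k))⁻¹ • q k with hv
  have hinQ : ∀ j k, inner ℝ (q j) (q k) =
      ∫ x, gw t s x * (gQ t j s).eval x * (gQ t k s).eval x ∂lam := by
    intro j k
    rw [L2.inner_def]
    have : ∫ x, inner ℝ (q j x) (q k x) ∂(gmu t s) =
        ∫ x, (gQ t j s).eval x * (gQ t k s).eval x ∂(gmu t s) := by
      apply integral_congr_ae
      filter_upwards [hq j, hq k] with x h1 h2
      rw [h1, h2]; simp; ring
    rw [this, gmu_integral]
    congr 1; ext x; ring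
  have hin : ∀ (F : Lp ℝ 2 (gmu t s)) k, inner ℝ F (v k) =
      (Real.sqrt (gN t s k))⁻¹ * ∫ x, gw t s x * F x * (gQ t k s).eval x ∂lam := by
    intro F k
    rw [hv]
    simp only
    rw [real_inner_smul_right, L2.inner_def]
    congr 1
    have : ∫ x, inner ℝ (F x) (q k x) ∂(gmu t s) =
        ∫ x, F x * (gQ t k s).eval x ∂(gmu t s) := by
      apply integral_congr_ae
      filter_upwards [hq k] with x h2
      rw [h2]; simp; ring
    rw [this, gmu_integral]
    congr 1; ext x; ring
  have hon : Orthonormal ℝ v := by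
    rw [orthonormal_iff_ite]
    intro j k
    rw [hv]
    simp only
    rw [real_inner_smul_left, real_inner_smul_right, hinQ]
    split_ifs with h
    · subst h
      rw [gQ_norm ht hs]
      have := gN_pos ht hs j
      have h2 := Real.sqrt_pos.2 this
      field_simp
      rw [Real.sq_sqrt this.le]
    · rw [gQ_orth ht hs h]; simp
  have hbot : (Submodule.span ℝ (Set.range v))ᗮ = ⊥ := by
    rw [Submodule.eq_bot_iff]
    intro F hF
    have h1 : ∀ k, ∫ x, gw t s x * F x * (gQ t k s).eval x ∂lam = 0 := by
      intro k
      have := (Submodule.mem_orthogonal' _ _).1 hF (v k) (Submodule.subset_span ⟨k, rfl⟩)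
      rw [hin] at this
      have h2 := Real.sqrt_pos.2 (gN_pos ht hs k)
      simpa [h2.ne'] using this
    have hFm : AEStronglyMeasurable F lam := (Lp.stronglyMeasurable F).aestronglyMeasurable
    have hF2 : Integrable (fun x => gw t s x * F x ^ 2) lam := by
      rw [← gmu_integrable]
      exact (Lp.memLp F).integrable_sq
    have := gQ_complete ht hs F hFm hF2 h1
    rw [Lp.eq_zero_iff_ae_eq_zero]
    exact (withDensity_absolutelyContinuous _ _) this
  have hfm := gmu_memLp t s hf hi
  obtain ⟨φ, hφ⟩ : ∃ φ : Lp ℝ 2 (gmu t s), φ =ᵐ[gmu t s] f := ⟨hfm.toLp, hfm.coeFn_toLp⟩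
  have hcoe : ∀ k, ∫ x, gw t s x * φ x * (gQ t k s).eval x ∂lam =
      ∫ x, gw t s x * f x * (gQ t k s).eval x ∂lam := by
    intro k
    simp only [mul_assoc]
    rw [← gmu_integral, ← gmu_integral]
    apply integral_congr_ae
    filter_upwards [hφ] with x hx
    rw [hx]
  have hs1 := (HilbertBasis.mkOfOrthogonalEqBot hon hbot).hasSum_inner_mul_inner
    φ φ
  rw [HilbertBasis.coe_mkOfOrthogonalEqBot] at hs1
  have e1 : (fun k => (∫ x, gw t s x * f x * (gQ t k s).eval x ∂lam) ^ 2 / gN t s k) =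
      fun k => inner ℝ φ (v k) * inner ℝ (v k) φ := by
    ext k
    rw [real_inner_comm φ (v k), hin, hcoe]
    have h3 := gN_pos ht hs k
    have h2 := Real.sqrt_pos.2 h3
    have h4 := Real.sq_sqrt h3.le
    rw [div_eq_mul_inv, ← h4]
    field_simp
    rw [Real.sqrt_sq h2.le]
  have e2 : ∫ x, gw t s x * f x ^ 2 ∂lam = inner ℝ φ φ := by
    rw [L2.inner_def, ← gmu_integral]
    apply integral_congr_ae
    filter_upwards [hφ] with x hx
    rw [hx]; simp
  rw [e1, e2]
  exact hs1

lemma fall_succ (x : ℝ) (k : ℕ) : fall x (k + 1) = fall x k * (x - k) := by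
  simp [fall, Finset.prod_range_succ]

lemma fall_zero (x : ℝ) : fall x 0 = 1 := by simp [fall]

lemma rise_zero (x : ℝ) : rise x 0 = 1 := by simp [rise]

lemma fall_succ' (x : ℝ) (k : ℕ) : fall x (k + 1) = x * fall (x - 1) k := by
  simp only [fall, Finset.prod_range_succ']
  simp only [Nat.cast_add, Nat.cast_one, Nat.cast_zero, sub_zero]
  rw [mul_comm]
  congr 1
  apply Finset.prod_congr rfl
  intro i _; ring

lemma fall_add (x : ℝ) (p q : ℕ) : fall x (p + q) = fall x p * fall (x - p) q := by
  simp only [fall, Finset.prod_range_add]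
  congr 1
  apply Finset.prod_congr rfl
  intro i _; push_cast; ring

lemma fall_nat (j i : ℕ) : fall j i = (j.descFactorial i : ℝ) := by
  induction i with
  | zero => simp [fall]
  | succ i ih =>
    rw [fall_succ, ih, Nat.descFactorial_succ]
    rcases Nat.lt_or_ge j i with h | h
    · simp [Nat.descFactorial_of_lt h]
    · push_cast [h]; ring

lemma fall_pos {x : ℝ} {k : ℕ} (h : (k : ℝ) < x + 1) : 0 < fall x k := by
  unfold fall
  apply Finset.prod_pos
  intro i hi
  have : (i : ℝ) + 1 ≤ k := by exact_mod_cast (Finset.mem_range.1 hi)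
  linarith

lemma rise_gamma {a : ℝ} (ha : 0 < a) (i : ℕ) :
    Real.Gamma (a + i) = rise a i * Real.Gamma a := by
  induction i with
  | zero => simp [rise]
  | succ i ih =>
    have : rise a (i + 1) = rise a i * (a + i) := by simp [rise, Finset.prod_range_succ]
    rw [this]
    push_cast
    rw [← add_assoc, Real.Gamma_add_one (by positivity), ih]; ring

lemma rise_pos {a : ℝ} (ha : 0 < a) (i : ℕ) : 0 < rise a i := by
  unfold rise
  apply Finset.prod_pos
  intro i hi
  positivity

lemma vandermonde (n : ℕ) : ∀ (k N : ℝ), (n : ℝ) < N + 1 →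
    ∑ i ∈ range (n + 1), (-1 : ℝ) ^ i * (n.choose i : ℝ) * (fall k i / fall N i) =
      fall (N - k) n / fall N n := by
  induction n with
  | zero => intro k N h; simp [fall]
  | succ n ih =>
    intro k N h
    push_cast at h
    have hn0 : (0 : ℝ) ≤ n := Nat.cast_nonneg n
    have h1 := ih k N (by linarith)
    have h2 := ih (k - 1) (N - 1) (by linarith)
    have hN : 0 < N := by linarith
    rw [Finset.sum_range_succ'] 
    have e : ∀ i ∈ range (n + 1), (-1 : ℝ) ^ (i + 1) * ((n + 1).choose (i + 1) : ℝ) *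
        (fall k (i + 1) / fall N (i + 1)) =
        (-1 : ℝ) ^ (i + 1) * (n.choose (i + 1) : ℝ) * (fall k (i + 1) / fall N (i + 1))
        - k / N * ((-1 : ℝ) ^ i * (n.choose i : ℝ) * (fall (k - 1) i / fall (N - 1) i)) := by
      intro i _
      rw [Nat.choose_succ_succ, fall_succ' k, fall_succ' N]
      push_cast
      rw [mul_div_mul_comm]
      ring
    rw [Finset.sum_congr rfl e, Finset.sum_sub_distrib, ← Finset.mul_sum, h2]
    have h3 := Finset.sum_range_succ' (fun i => (-1 : ℝ) ^ i * (n.choose i : ℝ) *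
      (fall k i / fall N i)) (n + 1)
    rw [Finset.sum_range_succ, h1] at h3
    simp only [Nat.choose_succ_self, Nat.cast_zero, mul_zero, zero_mul, add_zero] at h3
    simp only [Nat.choose_zero_right, pow_zero, fall_zero] at h3 ⊢
    have h4 : fall (N - 1 - (k - 1)) n = fall (N - k) n := by congr 1; ring
    rw [h4]
    have p1 : 0 < fall N n := fall_pos (by linarith)
    have p2 : 0 < fall (N - 1) n := fall_pos (by linarith)
    have r1 : fall N n * (N - n) = N * fall (N - 1) n := by rw [← fall_succ, fall_succ']
    have p3 : 0 < N - n := by linarith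
    have r2 : fall (N - k) n / fall N n = fall (N - k) n * (N - n) / (N * fall (N - 1) n) := by
      rw [← r1]; field_simp
    have r3 : fall (N - k) (n + 1) / fall N (n + 1) =
        fall (N - k) n * (N - k - n) / (N * fall (N - 1) n) := by
      rw [fall_succ (N - k), fall_succ' N]
    rw [r3]
    rw [r2] at h3
    have r4 : k / N * (fall (N - k) n / fall (N - 1) n) =
      fall (N - k) n * k / (N * fall (N - 1) n) := by field_simp
    rw [r4]
    have r5 : fall (N - k) n * (N - k - n) / (N * fall (N - 1) n) =
       fall (N - k) n * (N - n) / (N * fall (N - 1) n) -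
       fall (N - k) n * k / (N * fall (N - 1) n) := by rw [← sub_div]; congr 1; ring
    rw [r5, h3]
    simp
    ring

/-- The spectral coefficient. -/
def gB (m n j : ℕ) : ℝ :=
  ∑ i ∈ range (n + 1), (-1 : ℝ) ^ i * (n.choose i : ℝ) * (fall j i / fall ((m : ℝ) + n) i) -
    if j ≤ m then (m.choose j : ℝ) * j.factorial / fall ((m : ℝ) + n) j else 0

lemma gB_zero {m n j : ℕ} (h : j ≤ m + n) : gB m n j = 0 := by
  have hm0 : (0 : ℝ) ≤ m := Nat.cast_nonneg m
  have hn0 : (0 : ℝ) ≤ n := Nat.cast_nonneg n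
  unfold gB
  rw [vandermonde n j _ (by linarith)]
  split_ifs with hj
  · have hj' : (j : ℝ) ≤ m := by exact_mod_cast hj
    have p1 : 0 < fall ((m : ℝ) + n) n := fall_pos (by linarith)
    have p2 : 0 < fall ((m : ℝ) + n) j := fall_pos (by linarith)
    have e1 := fall_add ((m : ℝ) + n) j n
    have e2 := fall_add ((m : ℝ) + n) n j
    rw [add_comm j n, e2] at e1
    rw [add_sub_cancel_right, fall_nat, Nat.descFactorial_eq_factorial_mul_choose] at e1
    push_cast at e1
    rw [sub_eq_zero, div_eq_div_iff p1.ne' p2.ne']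
    linarith
  · have : fall ((m : ℝ) + n - j) n = 0 := by
      have : (m : ℝ) + n - j = ((m + n - j : ℕ) : ℝ) := by push_cast [h]; ring
      rw [this, fall_nat, Nat.descFactorial_of_lt (by omega)]; simp
    rw [this]; simp

lemma gB_pos {m n j : ℕ} (h : m + n < j) : 0 < (-1 : ℝ) ^ n * gB m n j := by
  have hm0 : (0 : ℝ) ≤ m := Nat.cast_nonneg m
  have hn0 : (0 : ℝ) ≤ n := Nat.cast_nonneg n
  unfold gB
  rw [vandermonde n j _ (by linarith), if_neg (by omega), sub_zero, ← mul_div_assoc]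
  apply div_pos _ (fall_pos (by linarith))
  have : (-1 : ℝ) ^ n * fall ((m : ℝ) + n - j) n = 
      ∏ i ∈ range n, ((j : ℝ) - (m + n) + i) := by
    have e : (-1 : ℝ) ^ n = ∏ i ∈ range n, (-1 : ℝ) := by simp
    rw [e, fall, ← Finset.prod_mul_distrib]
    apply Finset.prod_congr rfl
    intro i _; ring
  rw [this]
  apply Finset.prod_pos
  intro i _
  have : ((m + n : ℕ) : ℝ) < j := by exact_mod_cast h
  push_cast at this
  have : (0 : ℝ) ≤ i := Nat.cast_nonneg i
  linarith

lemma sum_Icc_one (f : ℕ → ℝ) (m : ℕ) :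
    ∑ i ∈ Finset.Icc 1 m, f i = ∑ i ∈ range (m + 1), f i - f 0 := by
  induction m with
  | zero => simp
  | succ m ih => rw [Finset.sum_Icc_succ_top (by omega), ih, Finset.sum_range_succ _ (m + 1)]; ring

/-- normalising constant -/
def gK (t a : ℝ) : ℝ := t ^ a / Real.Gamma a

lemma gK_pos {t a : ℝ} (ht : 0 < t) (ha : 0 < a) : 0 < gK t a := by
  have := Real.Gamma_pos_of_pos ha
  unfold gK; positivity

lemma gP_eq {t a : ℝ} (ht : 0 < t) (ha : 0 < a) :
    volume.withDensity (fun x => ENNReal.ofReal (gammaDensity a t x)) =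
      ENNReal.ofReal (gK t a) • gmu t a := by
  have e : (fun x => ENNReal.ofReal (gammaDensity a t x)) =
      (Set.Ioi (0 : ℝ)).indicator (ENNReal.ofReal (gK t a) • 
        fun x => ENNReal.ofReal (gw t a x)) := by
    ext x
    by_cases hx : 0 < x
    · rw [Set.indicator_of_mem (by exact hx)]
      simp only [gammaDensity, if_pos hx, Pi.smul_apply, smul_eq_mul]
      rw [← ENNReal.ofReal_mul (gK_pos ht ha).le, gK, gw, mul_assoc]
    · rw [Set.indicator_of_notMem (by exact hx)]
      simp [gammaDensity, hx]
  rw [e, withDensity_indicator measurableSet_Ioi, withDensity_smul _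
    (gw_measurable t a).ennreal_ofReal]
  rfl

lemma gP_prob {t a : ℝ} (ht : 0 < t) (ha : 0 < a) :
    IsProbabilityMeasure (ENNReal.ofReal (gK t a) • gmu t a) := by
  constructor
  rw [Measure.smul_apply, gmu, withDensity_apply _ MeasurableSet.univ, Measure.restrict_univ,
    ← ofReal_integral_eq_lintegral_ofReal (gw_integrableOn ht ha)
      (by filter_upwards [ae_lam_pos] with x hx; exact (gw_pos t a hx).le),
    gw_integral ht ha, smul_eq_mul, ← ENNReal.ofReal_mul (gK_pos ht ha).le, gK]
  have := Real.Gamma_pos_of_pos ha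
  have h2 : 0 < t ^ a := by positivity
  rw [div_mul_div_cancel₀ this.ne', div_self h2.ne']; simp

lemma gP_integral {t a : ℝ} (ht : 0 < t) (ha : 0 < a) (f : ℝ → ℝ) :
    ∫ x, f x ∂(ENNReal.ofReal (gK t a) • gmu t a) = gK t a * ∫ x, gw t a x * f x ∂lam := by
  rw [integral_smul_measure, gmu_integral, ENNReal.toReal_ofReal (gK_pos ht ha).le, smul_eq_mul]

lemma gP_integrable {t a : ℝ} (ht : 0 < t) (ha : 0 < a) (f : ℝ → ℝ) :
    Integrable f (ENNReal.ofReal (gK t a) • gmu t a) ↔ 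
      Integrable (fun x => gw t a x * f x) lam := by
  rw [integrable_smul_measure (by simpa using gK_pos ht ha) (by simp), gmu_integrable]

lemma gP_integral_pow {t a : ℝ} (ht : 0 < t) (ha : 0 < a) (i : ℕ) (f : ℝ → ℝ) :
    ∫ x, x ^ i * f x ∂(ENNReal.ofReal (gK t a) • gmu t a) =
      gK t a * ∫ x, gw t (a + i) x * f x ∂lam := by
  rw [gP_integral ht ha]
  congr 1
  apply integral_congr_ae
  filter_upwards [ae_lam_pos] with x hx
  rw [gw_add_nat t a i hx]; ring

lemma gP_integrable_pow {t a : ℝ} (ht : 0 < t) (ha : 0 < a) (i : ℕ) (f : ℝ → ℝ) :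
    Integrable (fun x => x ^ i * f x) (ENNReal.ofReal (gK t a) • gmu t a) ↔
      Integrable (fun x => gw t (a + i) x * f x) lam := by
  rw [gP_integrable ht ha]
  apply integrable_congr
  filter_upwards [ae_lam_pos] with x hx
  rw [gw_add_nat t a i hx]; ring

lemma MemH.acp {P : Measure ℝ} {m n : ℕ} {gd : ℕ → ℝ → ℝ} 
    (hg : MemH P (fun x => x) (Set.Ioi 0) m n gd) (k : ℕ) (hk : k < max m n) :
    ACp (gd k) (gd (k + 1)) := by
  obtain ⟨h1, h2, h3, -, -⟩ := hg
  have hcont : ∀ j < max m n, ContinuousOn (gd j) (Set.Ioi 0) := by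
    intro j hj
    by_cases hj2 : j + 1 < max m n
    · exact fun x hx => (h1 j hj2 x hx).continuousAt.continuousWithinAt
    · have : j = max m n - 1 := by omega
      rw [this]; exact h2 (by omega)
  intro x hx y hy
  by_cases hj2 : k + 1 < max m n
  · have hsub : Set.uIcc x y ⊆ Set.Ioi 0 := fun z hz => lt_of_lt_of_le (lt_min hx hy) hz.1
    have hi : IntervalIntegrable (gd (k + 1)) volume x y :=
      ((hcont (k + 1) hj2).mono hsub).intervalIntegrable
    refine ⟨hi, ?_⟩
    rw [intervalIntegral.integral_eq_sub_of_hasDerivAt (fun z hz => h1 k hj2 z (hsub hz)) hi]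
  · have e : k = max m n - 1 := by omega
    have e2 : k + 1 = max m n := by omega
    have := h3 (by omega) x hx y hy
    rw [← e, ← e2] at this
    exact this

lemma gN_ratio {t a : ℝ} (ht : 0 < t) (ha : 0 < a) (i k : ℕ) :
    gN t a (k + i) = gN t (a + i) k * ((k + i).descFactorial i * t ^ i) := by
  unfold gN
  rw [Real.rpow_add ht, Real.rpow_natCast]
  have : ((k + i).factorial : ℝ) = (k.factorial : ℝ) * ((k + i).descFactorial i : ℝ) := by
    rw [← Nat.cast_mul, ← Nat.factorial_mul_descFactorial (Nat.le_add_left i k)]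
    simp
  rw [this, show a + ((k + i : ℕ) : ℝ) = a + i + k by push_cast; ring]
  field_simp

open Polynomial in
/-- Vanishing coefficients beyond `N` iff polynomial. -/
lemma poly_of_coeff {t a : ℝ} (ht : 0 < t) (ha : 0 < a) (g : ℝ → ℝ)
    (hc : ContinuousOn g (Set.Ioi 0)) (hi : Integrable (fun x => gw t a x * g x ^ 2) lam) (N : ℕ)
    (h0 : ∀ k, N < k → ∫ x, gw t a x * g x * (gQ t k a).eval x ∂lam = 0) :
    IsPolyOn g (Set.Ioi 0) N := by
  set D : ℕ → ℝ := fun k => ∫ x, gw t a x * g x * (gQ t k a).eval x ∂lam with hD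
  set p : ℝ[X] := ∑ k ∈ range (N + 1), C (D k / gN t a k) * gQ t k a with hp
  have hgm : AEStronglyMeasurable g lam := hc.aestronglyMeasurable measurableSet_Ioi
  refine ⟨p, ?_, ?_⟩
  · apply natDegree_sum_le_of_forall_le
    intro k hk
    refine (natDegree_C_mul_le _ _).trans ((gQ_natDegree t k a).trans ?_)
    have := Finset.mem_range.1 hk; omega
  · have hpi := poly_l2 ht ha p
    have hi2 : Integrable (fun x => gw t a x * (g x - p.eval x) ^ 2) lam := by
      refine ((hi.const_mul 2).add (hpi.const_mul 2)).mono'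
        ((gw_measurable t a).aestronglyMeasurable.mul
          ((hgm.sub p.continuous.aestronglyMeasurable).pow 2)) ?_
      filter_upwards [ae_lam_pos] with x hx
      have hw := gw_pos t a hx
      rw [Real.norm_eq_abs, abs_of_nonneg (by positivity)]
      simp only [Pi.add_apply]
      have : (g x - p.eval x) ^ 2 ≤ 2 * g x ^ 2 + 2 * p.eval x ^ 2 := by
        nlinarith [sq_nonneg (g x + p.eval x)]
      nlinarith
    have hmg := fun d => mom_of_l2 ht ha hgm hi d
    have hcoef : ∀ k, ∫ x, gw t a x * (g x - p.eval x) * (gQ t k a).eval x ∂lam = 0 := by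
      intro k
      have e : ∀ x, gw t a x * (g x - p.eval x) * (gQ t k a).eval x =
          gw t a x * g x * (gQ t k a).eval x - ∑ j ∈ range (N + 1),
            D j / gN t a j * (gw t a x * (gQ t j a).eval x * (gQ t k a).eval x) := by
        intro x
        rw [mul_sub, sub_mul, hp, eval_finset_sum, Finset.mul_sum, Finset.sum_mul]
        congr 1
        apply Finset.sum_congr rfl
        intro j _
        simp; ring
      have hij : ∀ j, Integrable (fun x => gw t a x * (gQ t j a).eval x * (gQ t k a).eval x) lam :=
        fun j => (pair_eq (mom_poly ht ha (gQ t j a) _) (gQ t k a) le_rfl).1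
      simp only [e]
      rw [integral_sub (pair_eq (hmg _) _ le_rfl).1
        (integrable_finsetSum _ (fun j _ => (hij j).const_mul _)),
        integral_finsetSum _ (fun j _ => (hij j).const_mul _)]
      simp only [integral_const_mul]
      by_cases hk : k ≤ N
      · rw [Finset.sum_eq_single k]
        · rw [gQ_norm ht ha, div_mul_cancel₀ _ (gN_pos ht ha k).ne']
          simp [hD]
        · intro j _ hj
          rw [gQ_orth ht ha hj]; simp
        · intro h; exact absurd (Finset.mem_range.2 (by omega)) h
      · rw [h0 k (by omega), Finset.sum_eq_zero]
        · simp
        · intro j hj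
          have : j ≠ k := by have := Finset.mem_range.1 hj; omega
          rw [gQ_orth ht ha this]; simp
    have hz := gQ_complete ht ha (fun x => g x - p.eval x)
      (hgm.sub p.continuous.aestronglyMeasurable) hi2 hcoef
    have hae : g =ᵐ[lam] fun x => p.eval x := by
      filter_upwards [hz] with x hx
      have : g x - p.eval x = 0 := hx
      linarith
    exact Measure.eqOn_open_of_ae_eq hae isOpen_Ioi hc p.continuous.continuousOn

lemma hasSum_of_eq {f g : ℕ → ℝ} {b : ℝ} (hf : HasSum f b) (h : ∀ k, g k = f k) : HasSum g b := by
  rwa [show g = f from funext h]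

lemma gd_aesm {P : Measure ℝ} {m n : ℕ} {gd : ℕ → ℝ → ℝ} (hn : 1 ≤ n)
    (hg : MemH P (fun x => x) (Set.Ioi 0) m n gd) (i : ℕ) (hi : i ≤ max m n) :
    AEStronglyMeasurable (gd i) lam := by
  rcases i with _ | i
  · exact (hg.acp 0 (by omega)).continuousOn.aestronglyMeasurable measurableSet_Ioi
  · exact (hg.acp i (by omega)).aesm

lemma gd_l2 {t a : ℝ} (ht : 0 < t) (ha : 0 < a) {m n : ℕ} {gd : ℕ → ℝ → ℝ}
    (hg : MemH (ENNReal.ofReal (gK t a) • gmu t a) (fun x => x) (Set.Ioi 0) m n gd)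
    (i : ℕ) (hi : i ≤ n) :
    Integrable (fun x => gw t (a + i) x * gd i x ^ 2) lam := by
  induction hi using Nat.decreasingInduction with
  | self => exact (gP_integrable_pow ht ha n _).1 hg.2.2.2.1
  | of_succ k hk ih =>
    have e : a + ((k + 1 : ℕ) : ℝ) = (a + k) + 1 := by push_cast; ring
    rw [e] at ih
    exact (hg.acp k (by omega)).l2 ht (by positivity) ih

lemma gd_sq_hasSum {t a : ℝ} (ht : 0 < t) (ha : 0 < a) {m n : ℕ} (hn : 1 ≤ n) {gd : ℕ → ℝ → ℝ}
    (hg : MemH (ENNReal.ofReal (gK t a) • gmu t a) (fun x => x) (Set.Ioi 0) m n gd)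
    (i : ℕ) (hi : i ≤ n) :
    HasSum (fun j => (gK t a * (∫ x, gw t a x * gd 0 x * (gQ t j a).eval x ∂lam) ^ 2 / gN t a j)
      * (fall j i * t ^ i)) (∫ x, x ^ i * gd i x ^ 2 ∂(ENNReal.ofReal (gK t a) • gmu t a)) := by
  have hs : 0 < a + (i : ℝ) := by positivity
  have hm := gd_aesm hn hg i (by omega)
  have hl := gd_l2 ht ha hg i hi
  have hp := (gQ_parseval ht hs (gd i) hm hl).mul_left (gK t a)
  rw [gP_integral_pow ht ha, ← hasSum_nat_add_iff' i]
  have hz : ∑ j ∈ range i, (gK t a * (∫ x, gw t a x * gd 0 x * (gQ t j a).eval x ∂lam) ^ 2 /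
      gN t a j) * (fall j i * t ^ i) = 0 := by
    apply Finset.sum_eq_zero
    intro j hj
    rw [fall_nat, Nat.descFactorial_of_lt (Finset.mem_range.1 hj)]; simp
  rw [hz, sub_zero]
  refine hasSum_of_eq hp (fun k => ?_)
  have hc := (gQ_chain ht i gd a ha (fun k hk => hg.acp k (by omega)) k
    (mom_of_l2 ht hs hm hl k)).2
  have hN := gN_ratio ht ha i k
  have h1 := gN_pos ht hs k
  rw [hc, hN, fall_nat]
  have h2 : (0 : ℝ) < ((k + i).descFactorial i : ℝ) := by
    exact_mod_cast Nat.descFactorial_pos.2 (by omega)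
  field_simp

lemma gd_mean {t a : ℝ} (ht : 0 < t) (ha : 0 < a) {m n : ℕ} (hn : 1 ≤ n) {gd : ℕ → ℝ → ℝ}
    (hg : MemH (ENNReal.ofReal (gK t a) • gmu t a) (fun x => x) (Set.Ioi 0) m n gd)
    (i : ℕ) (hi : i ≤ m) :
    (∫ x, x ^ i * gd i x ∂(ENNReal.ofReal (gK t a) • gmu t a)) ^ 2 / rise a i =
      (gK t a * (∫ x, gw t a x * gd 0 x * (gQ t i a).eval x ∂lam) ^ 2 / gN t a i)
        * i.factorial := by
  have hs : 0 < a + (i : ℝ) := by positivity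
  have hm := gd_aesm hn hg i (by omega)
  have hM : Mom t (a + i) (gd i) 0 := by
    by_cases hin : i ≤ n
    · exact mom_of_l2 ht hs hm (gd_l2 ht ha hg i hin) 0
    · have h := (gP_integrable_pow ht ha i _).1 (hg.2.2.2.2 i (by omega) hi)
      intro j hj
      obtain rfl : j = 0 := by omega
      simp only [Nat.cast_zero, add_zero]
      refine h.mono ((gw_measurable t _).aestronglyMeasurable.mul hm) ?_
      filter_upwards with x
      simp
  have hc := (gQ_chain ht i gd a ha (fun k hk => hg.acp k (by omega)) 0 hM).2
  simp only [zero_add, show gQ t 0 (a + (i:ℝ)) = 1 from rfl, Polynomial.eval_one, mul_one] at hc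
  rw [gP_integral_pow ht ha, hc, gN, rise_gamma ha i, gK]
  have h1 := rise_pos ha i
  have h2 := Real.Gamma_pos_of_pos ha
  have h3 : (0 : ℝ) < t ^ a := Real.rpow_pos_of_pos ht a
  have h4 : (0 : ℝ) < (i.factorial : ℝ) := by positivity
  field_simp

lemma gd_hasSum {t a : ℝ} (ht : 0 < t) (ha : 0 < a) {m n : ℕ} (hn : 1 ≤ n) {gd : ℕ → ℝ → ℝ}
    (hg : MemH (ENNReal.ofReal (gK t a) • gmu t a) (fun x => x) (Set.Ioi 0) m n gd) :
    HasSum (fun j => (gK t a * (∫ x, gw t a x * gd 0 x * (gQ t j a).eval x ∂lam) ^ 2 / gN t a j)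
      * gB m n j) (variance (gd 0) (ENNReal.ofReal (gK t a) • gmu t a) -
        SgammaBound (ENNReal.ofReal (gK t a) • gmu t a) a t m n gd) := by
  have hprob := gP_prob ht ha
  have hA := fun i hi => gd_sq_hasSum ht ha hn hg i hi
  have hB := fun i hi => gd_mean ht ha hn hg i hi
  have hmem : MemLp (gd 0) 2 (ENNReal.ofReal (gK t a) • gmu t a) := by
    have h0 := gd_l2 ht ha hg 0 (by omega)
    simp only [Nat.cast_zero, add_zero] at h0
    exact (gmu_memLp t a (gd_aesm hn hg 0 (by omega)) h0).smul_measure (by simp)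
  have hvar := variance_eq_sub hmem
  set P := ENNReal.ofReal (gK t a) • gmu t a with hPdef
  set c : ℕ → ℝ := fun j =>
    gK t a * (∫ x, gw t a x * gd 0 x * (gQ t j a).eval x ∂lam) ^ 2 / gN t a j with hc
  have hval : variance (gd 0) P - SgammaBound P a t m n gd =
      ∑ i ∈ range (n + 1), ((-1 : ℝ) ^ i * ((n.choose i : ℝ) / (fall ((m : ℝ) + n) i * t ^ i))) *
        (∫ x, x ^ i * gd i x ^ 2 ∂P) -
      ∑ i ∈ range (m + 1), (m.choose i : ℝ) / fall ((m : ℝ) + n) i * (c i * i.factorial) := by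
    have e1 : ∑ i ∈ Finset.Icc 1 m, (m.choose i : ℝ) / (fall ((m : ℝ) + n) i * rise a i) *
        (∫ x, x ^ i * gd i x ∂P) ^ 2 =
        ∑ i ∈ Finset.Icc 1 m, (m.choose i : ℝ) / fall ((m : ℝ) + n) i * (c i * i.factorial) := by
      apply Finset.sum_congr rfl
      intro i hi
      rw [← hB i (Finset.mem_Icc.1 hi).2]
      rw [div_mul_div_comm, mul_comm (_ / _), ← mul_div_assoc, mul_comm]
    have e2 : ∑ i ∈ Finset.Icc 1 n,
      (-1 : ℝ) ^ (i - 1) * ((n.choose i : ℝ) / (fall ((m : ℝ) + n) i * t ^ i)) *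
        ∫ x, x ^ i * (gd i x) ^ 2 ∂P = - ∑ i ∈ Finset.Icc 1 n, 
        ((-1 : ℝ) ^ i * ((n.choose i : ℝ) / (fall ((m : ℝ) + n) i * t ^ i))) *
        (∫ x, x ^ i * gd i x ^ 2 ∂P) := by
      rw [← Finset.sum_neg_distrib]
      apply Finset.sum_congr rfl
      intro i hi
      obtain ⟨k, rfl⟩ : ∃ k, i = k + 1 := ⟨i - 1, by have := (Finset.mem_Icc.1 hi).1; omega⟩
      simp only [Nat.add_sub_cancel, pow_succ (-1 : ℝ)]
      ring
    have e3 := hB 0 (Nat.zero_le _)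
    simp only [pow_zero, one_mul, rise_zero, div_one, Nat.factorial_zero, Nat.cast_one,
      mul_one] at e3
    rw [SgammaBound, e1, e2, sum_Icc_one, sum_Icc_one, hvar, e3]
    simp only [fall_zero, pow_zero, Nat.choose_zero_right, Nat.cast_one, one_mul, mul_one,
      Nat.factorial_zero, div_one, Pi.pow_apply, hc]
    ring
  rw [hval]
  have s1 : HasSum (fun j => ∑ i ∈ range (n + 1),
      ((-1 : ℝ) ^ i * ((n.choose i : ℝ) / (fall ((m : ℝ) + n) i * t ^ i))) *
        (c j * (fall j i * t ^ i))) _ :=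
    hasSum_sum (fun i hi => (hA i (by have := Finset.mem_range.1 hi; omega)).mul_left
      ((-1 : ℝ) ^ i * ((n.choose i : ℝ) / (fall ((m : ℝ) + n) i * t ^ i))))
  have s2 : HasSum (fun j => if j ≤ m then (m.choose j : ℝ) / fall ((m : ℝ) + n) j *
      (c j * j.factorial) else 0)
      (∑ i ∈ range (m + 1), (m.choose i : ℝ) / fall ((m : ℝ) + n) i * (c i * i.factorial)) := by
    have := hasSum_sum_of_ne_finset_zero (s := range (m + 1)) (L := SummationFilter.unconditional ℕ)
      (f := fun j => if j ≤ m then (m.choose j : ℝ) / fall ((m : ℝ) + n) j *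
      (c j * j.factorial) else 0) (by
        intro j hj
        rw [if_neg]
        simpa using hj)
    convert this using 1
    apply Finset.sum_congr rfl
    intro i hi
    rw [if_pos (by have := Finset.mem_range.1 hi; omega)]
  refine hasSum_of_eq (s1.sub s2) (fun j => ?_)
  rw [gB, mul_sub]
  congr 1
  · rw [Finset.mul_sum]
    apply Finset.sum_congr rfl
    intro i _
    have := pow_pos ht i
    simp only [hc]
    field_simp
  · split_ifs
    · simp only [hc]; ring
    · simp

/-- **Theorem 2.1 for the gamma distribution.** -/
theorem gamma_variance_bound
    (a t : ℝ) (ha : 0 < a) (ht : 0 < t) (P : Measure ℝ)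
    (hP : P = volume.withDensity (fun x => ENNReal.ofReal (gammaDensity a t x)))
    (m n : ℕ) (hn : 1 ≤ n) (gd : ℕ → ℝ → ℝ)
    (hg : MemH P (fun x => x) (Set.Ioi 0) m n gd) :
    0 ≤ (-1 : ℝ) ^ n * (variance (gd 0) P - SgammaBound P a t m n gd) ∧
      (variance (gd 0) P = SgammaBound P a t m n gd ↔
        IsPolyOn (gd 0) (Set.Ioi 0) (m + n)) := by
  rw [gP_eq ht ha] at hP
  subst hP
  have hS := gd_hasSum ht ha hn hg
  have hS' := hS.mul_left ((-1 : ℝ) ^ n)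
  have hK := gK_pos ht ha
  have hnn : ∀ j, 0 ≤ (-1 : ℝ) ^ n *
      ((gK t a * (∫ x, gw t a x * gd 0 x * (gQ t j a).eval x ∂lam) ^ 2 / gN t a j)
      * gB m n j) := by
    intro j
    have hN := gN_pos ht ha j
    rw [mul_left_comm]
    refine mul_nonneg (by positivity) ?_
    rcases le_or_gt j (m + n) with h | h
    · rw [gB_zero h]; simp
    · exact (gB_pos h).le
  refine ⟨hS'.nonneg hnn, ?_, ?_⟩
  · intro h
    rw [h, sub_self, mul_zero] at hS'
    have hz := (hasSum_zero_iff_of_nonneg hnn).1 hS'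
    have h0 := gd_l2 ht ha hg 0 (by omega)
    simp only [Nat.cast_zero, add_zero] at h0
    refine poly_of_coeff ht ha (gd 0) (hg.acp 0 (by omega)).continuousOn h0 (m + n) ?_
    intro k hk
    have h1 := congrFun hz k
    simp only [Pi.zero_apply] at h1
    rw [mul_left_comm] at h1
    have h2 := (mul_eq_zero.1 h1).resolve_right (gB_pos hk).ne'
    have h3 := (div_eq_zero_iff.1 h2).resolve_right (gN_pos ht ha k).ne'
    exact pow_eq_zero_iff (two_ne_zero) |>.1 ((mul_eq_zero.1 h3).resolve_left hK.ne')
  · rintro ⟨p, hp, hgp⟩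
    have hz : ∀ j, (gK t a * (∫ x, gw t a x * gd 0 x * (gQ t j a).eval x ∂lam) ^ 2 / gN t a j)
      * gB m n j = 0 := by
      intro j
      rcases le_or_gt j (m + n) with h | h
      · rw [gB_zero h, mul_zero]
      · have e : ∫ x, gw t a x * gd 0 x * (gQ t j a).eval x ∂lam =
            ∫ x, gw t a x * p.eval x * (gQ t j a).eval x ∂lam := by
          apply integral_congr_ae
          filter_upwards [ae_lam_pos] with x hx
          rw [hgp x hx]
        rw [e, gQ_poly_zero ht ha p j (by omega)]
        simp
    simp only [hz] at hS
    exact sub_eq_zero.1 (hS.unique hasSum_zero)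

end
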